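/- arXiv:1705.06087 — 2 statements merged into one kernel-verified Lean document; each statement's English description precedes it below -/
import Mathlib

section
/- For every ε > 0 there exists a constant C = C(ε) > 0 such that for all integers m ≥ 2, all reals x, y with m ≥ x ≥ m^{1/2} and m ≥ y ≥ 1, and every integer a with gcd(a,m) = 1, the quantity T₂(a;x,y), the number of triples (p₁, p₂, v) with p₁, p₂ primes ≤ x coprime to m, v an integer with 1 ≤ v ≤ y, and a·p₁⁻¹·p₂⁻¹ ≡ v (mod m), satisfies |T₂(a;x,y) − π(x)²·y/m| ≤ C·x·m^{1/2+ε}. -/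
/-- The multiplicative inverse modulo `m` of `n`, as a natural number in `[0, m)`. -/
noncomputable def minv (m n : ℕ) : ℕ := ((n : ZMod m)⁻¹).val

/-- The prime counting function `π(x)`. -/
noncomputable def primePi (x : ℝ) : ℕ := {p : ℕ | p.Prime ∧ (p : ℝ) ≤ x}.ncard

/-- `T₂(a; x, y)`: the number of triples `(p₁, p₂, v)` with `p₁, p₂` primes at most `x`
coprime to `m`, `1 ≤ v ≤ y`, and `a · p₁⁻¹ · p₂⁻¹ ≡ v (mod m)`. -/
noncomputable def T2 (m : ℕ) (a : ℤ) (x y : ℝ) : ℕ :=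
  {t : ℕ × ℕ × ℕ | t.1.Prime ∧ t.2.1.Prime ∧ (t.1 : ℝ) ≤ x ∧ (t.2.1 : ℝ) ≤ x ∧
    Nat.Coprime t.1 m ∧ Nat.Coprime t.2.1 m ∧ 1 ≤ t.2.2 ∧ (t.2.2 : ℝ) ≤ y ∧
    a * (minv m t.1 : ℤ) * (minv m t.2.1 : ℤ) ≡ (t.2.2 : ℤ) [ZMOD (m : ℤ)]}.ncard

open Finset in
theorem divisor_bound (ε : ℝ) (hε : 0 < ε) : ∃ C : ℝ, 0 < C ∧ ∀ m : ℕ, m ≠ 0 →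
    (m.divisors.card : ℝ) ≤ C * (m : ℝ) ^ ε := by
  -- constant for one prime
  set K : ℝ := max 1 ((1/ε) / Real.log 2 + 1) with hK
  have hK1 : 1 ≤ K := le_max_left _ _
  have hlog2 : 0 < Real.log 2 := Real.log_pos (by norm_num)
  obtain ⟨M, hM⟩ := exists_nat_ge ((2:ℝ) ^ (1/ε))
  have h1 : ∀ (p k : ℕ), 2 ≤ p → ((k:ℝ) + 1) ≤ (if p < M then K else 1) * ((p:ℝ)^k) ^ ε := by
    intro p k hp
    have hp0 : (0:ℝ) < p := by positivity
    have hp2 : (2:ℝ) ≤ p := by exact_mod_cast hp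
    split_ifs with hpM
    · have : ((2:ℝ)^k)^ε ≤ ((p:ℝ)^k)^ε := by gcongr
      have h2 : 1 + ε * k * Real.log 2 ≤ ((2:ℝ)^k)^ε := by
        have : ((2:ℝ)^k)^ε = Real.exp (ε * k * Real.log 2) := by
          rw [← Real.rpow_natCast, ← Real.rpow_mul (by norm_num), Real.rpow_def_of_pos (by norm_num)]
          ring_nf
        rw [this]
        linarith [Real.add_one_le_exp (ε * k * Real.log 2)]
      have h3 : (k:ℝ) + 1 ≤ K * (1 + ε * k * Real.log 2) := by
        have e1 : (1/ε) / Real.log 2 ≤ K := by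
          have := le_max_right 1 ((1/ε) / Real.log 2 + 1); linarith
        have e2 : 1 ≤ K * (ε * Real.log 2) := by
          rw [div_div, div_le_iff₀ (by positivity)] at e1
          exact e1
        have : (k:ℝ) * 1 ≤ k * (K * (ε * Real.log 2)) := by gcongr
        nlinarith
      calc _ ≤ _ := h3
        _ ≤ _ := by gcongr; linarith
    · have hpM' : (2:ℝ)^(1/ε) ≤ p := hM.trans (by exact_mod_cast not_lt.mp hpM)
      have h2 : (2:ℝ) ≤ (p:ℝ)^ε := by
        calc (2:ℝ) = ((2:ℝ)^(1/ε))^ε := by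
              rw [← Real.rpow_mul (by norm_num)]; field_simp; simp
          _ ≤ _ := by gcongr
      have h3 : ((p:ℝ)^k)^ε = ((p:ℝ)^ε)^k := by
        rw [← Real.rpow_natCast, ← Real.rpow_natCast, ← Real.rpow_mul hp0.le, ← Real.rpow_mul hp0.le, mul_comm]
      rw [h3, one_mul]
      calc (k:ℝ)+1 ≤ 2^k := by exact_mod_cast Nat.lt_two_pow_self
        _ ≤ _ := by gcongr
  refine ⟨K^M, by positivity, fun m hm => ?_⟩
  rw [Nat.card_divisors hm]
  push_cast
  have hmprod : (m:ℝ)^ε = ∏ p ∈ m.primeFactors, (((p:ℝ)^(m.factorization p)) ^ ε) := by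
    rw [Real.finsetProd_rpow _ _ (fun i _ => by positivity)]
    congr 1
    conv_lhs => rw [← Nat.prod_factorization_pow_eq_self hm]
    rw [Finsupp.prod]; push_cast; rfl
  calc _ ≤ ∏ p ∈ m.primeFactors, ((if p < M then K else 1) * (((p:ℝ)^(m.factorization p)) ^ ε)) := by
        apply prod_le_prod
        · intros; positivity
        · intro p hp; exact h1 p _ (Nat.prime_of_mem_primeFactors hp).two_le
    _ = (∏ p ∈ m.primeFactors, (if p < M then K else 1)) * (m:ℝ)^ε := by
        rw [prod_mul_distrib, hmprod]
    _ ≤ _ := by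
        gcongr
        rw [prod_ite, prod_const, prod_const_one, mul_one]
        apply pow_le_pow_right₀ hK1
        calc _ ≤ (range M).card := card_le_card (fun p hp => by simp at hp ⊢; exact hp.2)
          _ = M := card_range M

open Finset in
theorem gcd_sum_bound (m : ℕ) (hm : 1 ≤ m) :
    ∑ h ∈ Ico 1 m, (Nat.gcd h m : ℝ) / h ≤ m.divisors.card * (1 + Real.log m) := by
  have hm0 : m ≠ 0 := by omega
  have key : ∀ d ∈ m.divisors, ∑ h ∈ Ico 1 m with d ∣ h, (d:ℝ)/h ≤ 1 + Real.log m := by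
    intro d hd
    have hd0 : 0 < d := Nat.pos_of_mem_divisors hd
    calc ∑ h ∈ Ico 1 m with d ∣ h, (d:ℝ)/h ≤ ∑ h ∈ (Icc 1 m).image (fun k => d * k), (d:ℝ)/h := by
          apply sum_le_sum_of_subset_of_nonneg
          · intro h hh
            simp only [mem_filter, mem_Ico] at hh
            obtain ⟨⟨h1, h2⟩, k, rfl⟩ := hh
            refine mem_image.2 ⟨k, ?_, rfl⟩
            rw [mem_Icc]
            constructor
            · by_contra hk
              have : k = 0 := by omega
              subst this; omega
            · nlinarith
          · intros; positivity
      _ = ∑ k ∈ Icc 1 m, ((k:ℝ))⁻¹ := by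
          rw [sum_image (fun a _ b _ h => Nat.eq_of_mul_eq_mul_left hd0 h)]
          apply sum_congr rfl
          intro k hk
          have : (0:ℝ) < k := by exact_mod_cast (mem_Icc.1 hk).1
          push_cast; field_simp
      _ ≤ _ := by
          have := harmonic_le_one_add_log m
          rw [harmonic_eq_sum_Icc] at this
          push_cast at this
          exact this
  calc ∑ h ∈ Ico 1 m, (Nat.gcd h m : ℝ) / h
      ≤ ∑ h ∈ Ico 1 m, ∑ d ∈ m.divisors, (if d ∣ h then (d:ℝ)/h else 0) := by
        apply sum_le_sum
        intro h hh
        have := single_le_sum (f := fun d => (if d ∣ h then (d:ℝ)/h else 0)) (s := m.divisors)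
          (fun i _ => by split_ifs <;> positivity)
          (Nat.mem_divisors.2 ⟨Nat.gcd_dvd_right h m, hm0⟩)
        simpa [Nat.gcd_dvd_left] using this
    _ = ∑ d ∈ m.divisors, ∑ h ∈ Ico 1 m with d ∣ h, (d:ℝ)/h := by
        rw [sum_comm]; simp only [sum_filter]
    _ ≤ ∑ d ∈ m.divisors, (1 + Real.log m) := sum_le_sum key
    _ = _ := by simp [mul_add]

-- annihilator
open Finset in
theorem ann_card (m : ℕ) [NeZero m] (c : ZMod m) :
    (univ.filter (fun z : ZMod m => c * z = 0)).card ≤ Nat.gcd c.val m := by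
  set g := Nat.gcd c.val m with hg
  have hg0 : 0 < g := Nat.gcd_pos_of_pos_right _ (NeZero.pos m)
  have hgm : g ∣ m := Nat.gcd_dvd_right _ _
  obtain ⟨n, hn⟩ := hgm
  have hn0 : 0 < n := by
    rcases Nat.eq_zero_or_pos n with h | h
    · have := NeZero.pos m; rw [hn, h] at this; omega
    · exact h
  calc _ ≤ ((range g).image (fun k => ((n * k : ℕ) : ZMod m))).card := by
        apply card_le_card
        intro z hz
        simp only [mem_filter, mem_univ, true_and] at hz
        have h1 : m ∣ c.val * z.val := by
          rw [← ZMod.natCast_eq_zero_iff]; simpa using hz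
        have h2 : n ∣ z.val := by
          obtain ⟨c', hc'⟩ := Nat.gcd_dvd_left c.val m
          rw [← hg] at hc'
          have hcop : Nat.Coprime n c' := by
            have h3 := Nat.coprime_div_gcd_div_gcd (m := c.val) (n := m) hg0
            rw [← hg] at h3
            have e1 : c.val / g = c' := by rw [hc']; exact Nat.mul_div_cancel_left _ hg0
            have e2 : m / g = n := by rw [Nat.div_eq_of_eq_mul_right hg0 hn]
            rw [e1, e2] at h3; exact h3.symm
          rw [hc'] at h1
          have : g * n ∣ g * (c' * z.val) := by rw [← hn, ← mul_assoc]; exact h1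
          exact hcop.dvd_of_dvd_mul_left (Nat.dvd_of_mul_dvd_mul_left hg0 this)
        obtain ⟨k, hk⟩ := h2
        refine mem_image.2 ⟨k, ?_, ?_⟩
        · rw [mem_range]
          have := ZMod.val_lt z
          by_contra hcon
          have : n * g ≤ n * k := Nat.mul_le_mul_left _ (not_lt.1 hcon)
          rw [mul_comm n g, ← hn, ← hk] at this
          omega
        · rw [← hk]; simp
    _ ≤ (range g).card := card_image_le
    _ = g := card_range g

-- interval Fourier coefficient
open Finset in
theorem interval_bound (m : ℕ) [NeZero m] (Y : ℕ) (h : ℕ) (h1 : 1 ≤ h) (h2 : h < m) :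
    ‖∑ v ∈ Icc 1 Y, (ZMod.stdAddChar (-(h : ZMod m) * (v : ZMod m)) : ℂ)‖
      ≤ (m:ℝ)/2 * (1/h + 1/((m - h : ℕ) : ℝ)) := by
  have hm0 : (0:ℝ) < m := by exact_mod_cast NeZero.pos m
  have hh0 : (0:ℝ) < h := by exact_mod_cast h1
  have hmh : ((m - h : ℕ) : ℝ) = m - h := by rw [Nat.cast_sub h2.le]
  have hmh0 : (0:ℝ) < m - h := by rw [← hmh]; exact_mod_cast Nat.sub_pos_of_lt h2
  set w : ℂ := ZMod.stdAddChar (-(h : ZMod m)) with hw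
  have hwn : ‖w‖ = 1 := AddChar.norm_apply _ _
  have hsum : ∑ v ∈ Icc 1 Y, (ZMod.stdAddChar (-(h : ZMod m) * (v : ZMod m)) : ℂ)
      = w * ∑ i ∈ range Y, w ^ i := by
    rw [mul_sum, ← Ico_add_one_right_eq_Icc, sum_Ico_eq_sum_range]
    simp only [Nat.add_sub_cancel]
    apply sum_congr rfl
    intro i _
    rw [hw, ← pow_succ', ← AddChar.map_nsmul_eq_pow]
    congr 1
    simp [nsmul_eq_mul]; ring
  have hw1 : ‖w - 1‖ = 2 * |Real.sin (Real.pi * h / m)| := by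
    have : w = Complex.exp (Complex.I * ((-(2 * Real.pi * h / m) : ℝ) : ℂ)) := by
      have := ZMod.stdAddChar_coe (N := m) (-(h:ℤ))
      push_cast at this
      rw [hw, this]
      congr 1
      push_cast; ring
    rw [this, Complex.norm_exp_I_mul_ofReal_sub_one, norm_mul]
    have e : -(2 * Real.pi * h / m) / 2 = -(Real.pi * h / m) := by ring
    rw [e, Real.sin_neg]; simp
  have hsin : 2 * (min (h:ℝ) (m - h)) / m ≤ Real.sin (Real.pi * h / m) := by
    rcases le_total (h:ℝ) (m - h) with hle | hle
    · rw [min_eq_left hle]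
      have := Real.mul_le_sin (x := Real.pi * h / m) (by positivity) (by
        rw [div_le_div_iff₀ hm0 (by norm_num)]; nlinarith [Real.pi_pos])
      calc _ = 2 / Real.pi * (Real.pi * h / m) := by field_simp
        _ ≤ _ := this
    · rw [min_eq_right hle]
      have := Real.mul_le_sin (x := Real.pi * (m - h) / m) (by positivity) (by
        rw [div_le_div_iff₀ hm0 (by norm_num)]; nlinarith [Real.pi_pos])
      calc _ = 2 / Real.pi * (Real.pi * (m - h) / m) := by field_simp
        _ ≤ _ := this
        _ = _ := by
          rw [← Real.sin_pi_sub]; congr 1; field_simp; ring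
  have hmin : 0 < min (h:ℝ) (m - h) := lt_min hh0 hmh0
  have hw1' : 4 * (min (h:ℝ) (m - h)) / m ≤ ‖w - 1‖ := by
    rw [hw1]
    have := le_abs_self (Real.sin (Real.pi * h / m))
    calc _ = 2 * (2 * (min (h:ℝ) (m - h)) / m) := by ring
      _ ≤ _ := by linarith
  have hpos : 0 < ‖w - 1‖ := lt_of_lt_of_le (by positivity) hw1'
  have hne : w ≠ 1 := by
    intro h; rw [h] at hpos; simp at hpos
  rw [hsum, geom_sum_eq hne, norm_mul, hwn, one_mul, norm_div]
  have hnum : ‖w ^ Y - 1‖ ≤ 2 := by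
    calc _ ≤ ‖w^Y‖ + ‖(1:ℂ)‖ := norm_sub_le _ _
      _ = 2 := by rw [norm_pow, hwn]; norm_num
  calc _ ≤ 2 / (4 * (min (h:ℝ) (m - h)) / m) := by gcongr
    _ = (m:ℝ)/2 * (1 / min (h:ℝ) (m - h)) := by field_simp; norm_num
    _ ≤ _ := by
      rw [hmh]
      gcongr
      rcases le_total (h:ℝ) (m - h) with hle | hle
      · rw [min_eq_left hle]
        have : 0 < 1/((m:ℝ)-h) := by positivity
        linarith
      · rw [min_eq_right hle]
        have : 0 < 1/(h:ℝ) := by positivity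
        linarith

-- bilinear bound
open Finset in
theorem bilinear_bound (m : ℕ) [NeZero m] (W : Finset (ZMod m)) (c : ZMod m) :
    ‖∑ u ∈ W, ∑ w ∈ W, (ZMod.stdAddChar (c * u * w) : ℂ)‖
      ≤ W.card * Real.sqrt m * (univ.filter (fun z : ZMod m => c * z = 0)).card := by
  set G := (univ.filter (fun z : ZMod m => c * z = 0)).card with hG
  have hG1 : 1 ≤ G := card_pos.2 ⟨0, by simp⟩
  have hsq : ∑ u : ZMod m, ‖∑ w ∈ W, (ZMod.stdAddChar (c * u * w) : ℂ)‖^2 ≤ m * (W.card * G) := by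
    have e1 : ((∑ u : ZMod m, ‖∑ w ∈ W, (ZMod.stdAddChar (c * u * w) : ℂ)‖^2 : ℝ) : ℂ)
        = ∑ w ∈ W, ∑ w' ∈ W, if c * (w - w') = 0 then (m:ℂ) else 0 := by
      push_cast
      have : ∀ u : ZMod m, ((‖∑ w ∈ W, (ZMod.stdAddChar (c * u * w) : ℂ)‖:ℂ)^2)
          = ∑ w ∈ W, ∑ w' ∈ W, (ZMod.stdAddChar (u * (c * (w - w'))) : ℂ) := by
        intro u
        rw [← Complex.mul_conj', map_sum, sum_mul_sum]
        refine sum_congr rfl fun w _ => sum_congr rfl fun w' _ => ?_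
        rw [← AddChar.map_neg_eq_conj, ← AddChar.map_add_eq_mul]
        congr 1; ring
      simp_rw [this]
      rw [sum_comm]
      refine sum_congr rfl fun w _ => ?_
      rw [sum_comm]
      refine sum_congr rfl fun w' _ => ?_
      rw [AddChar.sum_mulShift _ (ZMod.isPrimitive_stdAddChar m)]
      simp [ZMod.card]
    have e2 : ∑ u : ZMod m, ‖∑ w ∈ W, (ZMod.stdAddChar (c * u * w) : ℂ)‖^2
        = ∑ w ∈ W, ∑ w' ∈ W, if c * (w - w') = 0 then (m:ℝ) else 0 := by
      apply Complex.ofReal_injective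
      rw [e1]; push_cast
      refine sum_congr rfl fun w _ => sum_congr rfl fun w' _ => ?_
      split_ifs <;> simp
    rw [e2]
    calc _ ≤ ∑ w ∈ W, (m:ℝ) * G := by
          apply sum_le_sum
          intro w _
          rw [← sum_filter, sum_const, nsmul_eq_mul, mul_comm]
          gcongr
          rw [hG]
          apply card_le_card_of_injOn (fun w' => w - w')
          · intro w' hw'
            simp at hw' ⊢
            exact hw'.2
          · intro a _ b _ hab
            simpa using hab
      _ = _ := by rw [sum_const, nsmul_eq_mul]; ring
  have hcs : ‖∑ u ∈ W, ∑ w ∈ W, (ZMod.stdAddChar (c * u * w) : ℂ)‖^2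
      ≤ (W.card * Real.sqrt m * G)^2 := by
    calc _ ≤ (∑ u ∈ W, ‖∑ w ∈ W, (ZMod.stdAddChar (c * u * w) : ℂ)‖)^2 := by
          gcongr; exact norm_sum_le _ _
      _ ≤ W.card * ∑ u ∈ W, ‖∑ w ∈ W, (ZMod.stdAddChar (c * u * w) : ℂ)‖^2 :=
          sq_sum_le_card_mul_sum_sq
      _ ≤ W.card * ∑ u : ZMod m, ‖∑ w ∈ W, (ZMod.stdAddChar (c * u * w) : ℂ)‖^2 := by
          gcongr
          · exact subset_univ _
      _ ≤ W.card * (m * (W.card * G)) := by gcongr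
      _ = (W.card)^2 * m * G := by ring
      _ ≤ (W.card)^2 * m * G^2 := by
          gcongr
          exact_mod_cast Nat.le_self_pow (by norm_num) G
      _ = _ := by rw [mul_pow, mul_pow, Real.sq_sqrt (by positivity)]
  exact (pow_le_pow_iff_left₀ (norm_nonneg _) (by positivity) (by norm_num)).1 hcs

open Finset in
theorem core_bound (m : ℕ) [NeZero m] (W : Finset (ZMod m)) (a : ZMod m) (ha : IsUnit a) (Y : ℕ) :
    |((∑ u ∈ W, ∑ w ∈ W, ∑ v ∈ Icc 1 Y, if a * u * w = (v : ZMod m) then (1:ℝ) else 0)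
      - (W.card:ℝ)^2 * Y / m)|
      ≤ W.card * Real.sqrt m * (m.divisors.card * (1 + Real.log m)) := by
  have hmpos : 0 < m := NeZero.pos m
  have hm0 : (0:ℝ) < m := by exact_mod_cast hmpos
  set N : ℝ := ∑ u ∈ W, ∑ w ∈ W, ∑ v ∈ Icc 1 Y, if a * u * w = (v : ZMod m) then (1:ℝ) else 0
    with hN
  set B : ZMod m → ℂ := fun h => ∑ u ∈ W, ∑ w ∈ W, (ZMod.stdAddChar ((h * a) * u * w) : ℂ) with hB
  set D : ZMod m → ℂ := fun h => ∑ v ∈ Icc 1 Y, (ZMod.stdAddChar (-h * (v : ZMod m)) : ℂ) with hD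
  have hmain : ((m * N : ℝ) : ℂ) = ∑ h : ZMod m, B h * D h := by
    have e1 : ∀ h, B h * D h = ∑ u ∈ W, ∑ w ∈ W, ∑ v ∈ Icc 1 Y,
        (ZMod.stdAddChar (h * (a * u * w - (v : ZMod m))) : ℂ) := by
      intro h
      simp only [hB, hD, sum_mul, mul_sum]
      rw [sum_comm]
      refine sum_congr rfl fun u _ => ?_
      rw [sum_comm]
      refine sum_congr rfl fun w _ => ?_
      refine sum_congr rfl fun v _ => ?_
      rw [← AddChar.map_add_eq_mul]
      congr 1; ring
    simp_rw [e1]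
    rw [sum_comm, hN]
    push_cast
    rw [mul_sum]
    refine sum_congr rfl fun u _ => ?_
    rw [mul_sum, sum_comm]
    refine sum_congr rfl fun w _ => ?_
    rw [mul_sum, sum_comm]
    refine sum_congr rfl fun v _ => ?_
    rw [AddChar.sum_mulShift _ (ZMod.isPrimitive_stdAddChar m)]
    simp only [ZMod.card, sub_eq_zero]
    split_ifs <;> simp
  have hzero : B 0 * D 0 = (((W.card:ℝ)^2 * Y : ℝ) : ℂ) := by
    simp only [hB, hD, zero_mul, neg_zero, AddChar.map_zero_eq_one, sum_const, Nat.card_Icc]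
    simp only [nsmul_eq_mul, Nat.add_sub_cancel]
    push_cast; ring
  have hdiff : ((m * N - (W.card:ℝ)^2 * Y : ℝ) : ℂ) = ∑ h ∈ univ.erase (0 : ZMod m), B h * D h := by
    rw [Complex.ofReal_sub, hmain, ← hzero, ← add_sum_erase univ _ (mem_univ (0 : ZMod m))]
    ring
  have hBb : ∀ h, ‖B h‖ ≤ W.card * Real.sqrt m * (Nat.gcd h.val m : ℝ) := by
    intro h
    refine (bilinear_bound m W (h * a)).trans ?_
    gcongr
    refine le_trans (le_of_eq ?_) (ann_card m h)
    congr 1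
    ext z
    simp only [mem_filter, mem_univ, true_and]
    rw [show h * a * z = a * (h * z) by ring]
    exact ha.mul_right_eq_zero
  have hre : ∑ h ∈ univ.erase (0 : ZMod m), ‖B h * D h‖
      = ∑ h ∈ Ico 1 m, ‖B (h : ZMod m) * D (h : ZMod m)‖ := by
    apply sum_nbij' (fun z : ZMod m => z.val) (fun n : ℕ => (n : ZMod m))
    · intro z hz
      simp only [mem_erase, mem_univ, and_true] at hz
      rw [mem_Ico]
      exact ⟨Nat.pos_of_ne_zero (by rwa [Ne, ZMod.val_eq_zero]), ZMod.val_lt z⟩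
    · intro n hn
      rw [mem_Ico] at hn
      simp only [mem_erase, mem_univ, and_true]
      rw [Ne, ZMod.natCast_eq_zero_iff]
      intro hd
      have := Nat.le_of_dvd (by omega) hd
      omega
    · intro z _; simp
    · intro n hn
      rw [mem_Ico] at hn
      exact ZMod.val_cast_of_lt hn.2
    · intro z _; simp
  have hfin : |m * N - (W.card:ℝ)^2 * Y| ≤
      m * (W.card * Real.sqrt m * (m.divisors.card * (1 + Real.log m))) := by
    have hrefl : ∑ h ∈ Ico 1 m, (Nat.gcd h m : ℝ) * (1 / ((m - h : ℕ) : ℝ))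
        = ∑ h ∈ Ico 1 m, (Nat.gcd h m : ℝ) / h := by
      apply sum_nbij' (fun h => m - h) (fun h => m - h)
      · intro h hh; rw [mem_Ico] at *; omega
      · intro h hh; rw [mem_Ico] at *; omega
      · intro h hh; rw [mem_Ico] at hh; omega
      · intro h hh; rw [mem_Ico] at hh; omega
      · intro h hh; rw [mem_Ico] at hh
        have : Nat.gcd (m - h) m = Nat.gcd h m := by
          rw [Nat.gcd_comm, Nat.gcd_self_sub_right hh.2.le, Nat.gcd_comm]
        rw [this, mul_one_div]
    calc |m * N - (W.card:ℝ)^2 * Y| = ‖((m * N - (W.card:ℝ)^2 * Y : ℝ) : ℂ)‖ := by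
          rw [Complex.norm_real, Real.norm_eq_abs]
      _ ≤ ∑ h ∈ univ.erase (0 : ZMod m), ‖B h * D h‖ := by rw [hdiff]; exact norm_sum_le _ _
      _ = ∑ h ∈ Ico 1 m, ‖B (h : ZMod m) * D (h : ZMod m)‖ := hre
      _ ≤ ∑ h ∈ Ico 1 m, (W.card * Real.sqrt m * (Nat.gcd h m : ℝ)) *
            ((m:ℝ)/2 * (1/h + 1/((m - h : ℕ) : ℝ))) := by
          apply sum_le_sum
          intro h hh
          rw [mem_Ico] at hh
          rw [norm_mul]
          have h1 := hBb (h : ZMod m)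
          rw [ZMod.val_cast_of_lt hh.2] at h1
          have h2 := interval_bound m Y h hh.1 hh.2
          exact mul_le_mul h1 h2 (norm_nonneg _) (by positivity)
      _ = (W.card * Real.sqrt m * (m/2)) * (∑ h ∈ Ico 1 m, (Nat.gcd h m : ℝ) / h
            + ∑ h ∈ Ico 1 m, (Nat.gcd h m : ℝ) * (1 / ((m - h : ℕ) : ℝ))) := by
          rw [← sum_add_distrib, mul_sum]
          refine sum_congr rfl fun h _ => ?_
          ring
      _ = (W.card * Real.sqrt m * m) * (∑ h ∈ Ico 1 m, (Nat.gcd h m : ℝ) / h) := by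
          rw [hrefl]; ring
      _ ≤ (W.card * Real.sqrt m * m) * (m.divisors.card * (1 + Real.log m)) := by
          gcongr
          exact gcd_sum_bound m hmpos
      _ = _ := by ring
  have e : N - (W.card:ℝ)^2 * Y / m = (m * N - (W.card:ℝ)^2 * Y) / m := by field_simp
  rw [e, abs_div, abs_of_pos hm0, div_le_iff₀ hm0, mul_comm _ (m:ℝ)]
  exact hfin

/-- Primes up to `x` coprime to `m`. -/
noncomputable def goodPrimes (m : ℕ) (x : ℝ) : Finset ℕ :=
  (Finset.range (⌊x⌋₊ + 1)).filter (fun p => p.Prime ∧ Nat.Coprime p m)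

theorem mem_goodPrimes (m : ℕ) (x : ℝ) (hx : 0 ≤ x) (p : ℕ) :
    p ∈ goodPrimes m x ↔ p.Prime ∧ (p : ℝ) ≤ x ∧ Nat.Coprime p m := by
  rw [goodPrimes, Finset.mem_filter, Finset.mem_range, Nat.lt_succ_iff, Nat.le_floor_iff hx]
  tauto

open Finset in
theorem T2_eq (m : ℕ) (hm : 2 ≤ m) [NeZero m] (a : ℤ) (x y : ℝ) (hx : 0 ≤ x) (hxm : x ≤ m)
    (hy : 0 ≤ y) : ∃ W : Finset (ZMod m), W.card = (goodPrimes m x).card ∧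
    (T2 m a x y : ℝ) = ∑ u ∈ W, ∑ w ∈ W, ∑ v ∈ Icc 1 ⌊y⌋₊,
      if (a : ZMod m) * u * w = (v : ZMod m) then (1:ℝ) else 0 := by
  set S := goodPrimes m x with hS
  have hinj : Set.InjOn (fun p : ℕ => ((p : ZMod m))⁻¹) (S : Set ℕ) := by
    intro p hp q hq hpq
    have hp' := (mem_goodPrimes m x hx p).1 hp
    have hq' := (mem_goodPrimes m x hx q).1 hq
    have lt : ∀ r : ℕ, (r.Prime ∧ (r : ℝ) ≤ x ∧ Nat.Coprime r m) → r < m := by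
      rintro r ⟨_, h2, h3⟩
      have : r ≤ m := by exact_mod_cast h2.trans hxm
      refine lt_of_le_of_ne this ?_
      rintro rfl
      rw [Nat.coprime_self] at h3
      omega
    dsimp only at hpq
    have h1 := ZMod.coe_mul_inv_eq_one p hp'.2.2
    have h2 := ZMod.coe_mul_inv_eq_one q hq'.2.2
    have h3 : (p : ZMod m) = (q : ZMod m) := by
      calc (p : ZMod m) = p * (q * (q : ZMod m)⁻¹) := by rw [h2, mul_one]
        _ = q * (p * (p : ZMod m)⁻¹) := by rw [hpq]; ring
        _ = q := by rw [h1, mul_one]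
    have := congrArg ZMod.val h3
    rwa [ZMod.val_cast_of_lt (lt p hp'), ZMod.val_cast_of_lt (lt q hq')] at this
  refine ⟨S.image (fun p : ℕ => ((p : ZMod m))⁻¹), card_image_of_injOn hinj, ?_⟩
  rw [sum_image hinj]
  have : {t : ℕ × ℕ × ℕ | t.1.Prime ∧ t.2.1.Prime ∧ (t.1 : ℝ) ≤ x ∧ (t.2.1 : ℝ) ≤ x ∧
    Nat.Coprime t.1 m ∧ Nat.Coprime t.2.1 m ∧ 1 ≤ t.2.2 ∧ (t.2.2 : ℝ) ≤ y ∧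
    a * (minv m t.1 : ℤ) * (minv m t.2.1 : ℤ) ≡ (t.2.2 : ℤ) [ZMOD (m : ℤ)]}
    = (((S ×ˢ S ×ˢ Icc 1 ⌊y⌋₊).filter (fun t : ℕ × ℕ × ℕ =>
      (a : ZMod m) * (t.1 : ZMod m)⁻¹ * (t.2.1 : ZMod m)⁻¹ = (t.2.2 : ZMod m)) :
        Finset (ℕ × ℕ × ℕ)) : Set (ℕ × ℕ × ℕ)) := by
    ext ⟨p, q, v⟩
    simp only [Set.mem_ofPred_eq, coe_filter, mem_product, mem_Icc, hS, mem_goodPrimes m x hx,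
      Nat.le_floor_iff hy]
    rw [← ZMod.intCast_eq_intCast_iff]
    have : ∀ n : ℕ, ((minv m n : ℕ) : ZMod m) = (n : ZMod m)⁻¹ := by
      intro n; simp [minv]
    push_cast
    rw [this, this]
    tauto
  rw [T2, this, Set.ncard_coe_finset, card_filter, sum_product]
  push_cast
  refine sum_congr rfl fun p _ => ?_
  rw [sum_product, sum_image hinj]

open Finset in
theorem main_term (m : ℕ) (hm : 2 ≤ m) (x y : ℝ) (hx : 0 ≤ x) (hxm : x ≤ m) (hy : 0 ≤ y)
    (hym : y ≤ m) :
    ((goodPrimes m x).card : ℝ) ≤ x ∧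
    |((goodPrimes m x).card : ℝ)^2 * (⌊y⌋₊ : ℝ) / m - (primePi x : ℝ)^2 * y / m|
      ≤ x * (1 + 2 * m.divisors.card) := by
  have hm0 : (0:ℝ) < m := by exact_mod_cast (by omega : 0 < m)
  set A := (range (⌊x⌋₊ + 1)).filter (fun p => p.Prime) with hA
  have hpi : primePi x = A.card := by
    rw [primePi, ← Set.ncard_coe_finset]
    congr 1
    ext p
    simp only [hA, Set.mem_ofPred_eq, coe_filter, mem_range, Nat.lt_succ_iff, Nat.le_floor_iff hx]
    tauto
  have hsub : goodPrimes m x ⊆ A := by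
    intro p hp
    simp only [goodPrimes, hA, mem_filter] at *
    tauto
  have hAx : (A.card : ℝ) ≤ x := by
    have : A.card ≤ (Icc 1 ⌊x⌋₊).card := by
      apply card_le_card
      intro p hp
      simp only [hA, mem_filter, mem_range] at hp
      rw [mem_Icc]
      exact ⟨hp.2.one_lt.le, by omega⟩
    rw [Nat.card_Icc, Nat.add_sub_cancel] at this
    exact le_trans (by exact_mod_cast this) (Nat.floor_le hx)
  have hle : ((goodPrimes m x).card : ℝ) ≤ A.card := by exact_mod_cast card_le_card hsub
  have hdiff : (A.card : ℝ) ≤ (goodPrimes m x).card + m.divisors.card := by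
    have : A ⊆ goodPrimes m x ∪ m.divisors := by
      intro p hp
      simp only [goodPrimes, hA, mem_filter, mem_union, Nat.mem_divisors] at *
      by_cases hd : p ∣ m
      · right; exact ⟨hd, by omega⟩
      · left; exact ⟨hp.1, hp.2, (Nat.Prime.coprime_iff_not_dvd hp.2).2 hd⟩
    exact_mod_cast (card_le_card this).trans (card_union_le _ _)
  refine ⟨hle.trans hAx, ?_⟩
  rw [hpi]
  have hY1 := Nat.floor_le hy
  have hY2 := Nat.lt_floor_add_one y
  set P : ℝ := ((goodPrimes m x).card : ℝ) with hP
  set Q : ℝ := (A.card : ℝ) with hQ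
  set d : ℝ := (m.divisors.card : ℝ) with hd
  set Y : ℝ := (⌊y⌋₊ : ℝ) with hY
  have hP0 : 0 ≤ P := Nat.cast_nonneg _
  have hd0 : 0 ≤ d := Nat.cast_nonneg _
  have hY0 : 0 ≤ Y := Nat.cast_nonneg _
  have hPQ : P^2 ≤ Q^2 := by gcongr
  have h1 : P^2 * Y ≤ Q^2 * y := by gcongr
  rw [← sub_div, abs_div, abs_of_pos hm0, abs_sub_comm, abs_of_nonneg (by linarith),
    div_le_iff₀ hm0]
  have h2 : Q^2 * (y - Y) ≤ x * m := by
    calc _ ≤ Q^2 * 1 := by gcongr; linarith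
      _ = Q * Q := by ring
      _ ≤ x * m := mul_le_mul hAx (hAx.trans hxm) (by linarith) hx
  have h3 : Q^2 - P^2 ≤ 2 * x * d := by
    calc Q^2 - P^2 = (Q + P) * (Q - P) := by ring
      _ ≤ (2 * x) * d := mul_le_mul (by linarith) (by linarith) (by linarith) (by linarith)
  have h4 : (Q^2 - P^2) * Y ≤ (2 * x * d) * m :=
    mul_le_mul h3 (hY1.trans hym) hY0 (by positivity)
  nlinarith

theorem stmt_12 : ∀ ε : ℝ, 0 < ε → ∃ C : ℝ, 0 < C ∧ ∀ m : ℕ, 2 ≤ m → ∀ x y : ℝ,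
    (m : ℝ) ^ ((1 : ℝ) / 2) ≤ x → x ≤ m → 1 ≤ y → y ≤ m →
    ∀ a : ℤ, Int.gcd a m = 1 →
    |(T2 m a x y : ℝ) - (primePi x : ℝ) ^ 2 * y / m|
      ≤ C * x * (m : ℝ) ^ ((1 : ℝ) / 2 + ε) := by
  intro ε hε
  obtain ⟨K, hK, hdiv⟩ := divisor_bound (ε/2) (by positivity)
  refine ⟨K * (1 + 2/ε) + 1 + 2 * K, by positivity, ?_⟩
  intro m hm x y hx hxm hy hym a ha
  have : NeZero m := ⟨by omega⟩
  have hm1 : (1:ℝ) ≤ m := by exact_mod_cast (by omega : 1 ≤ m)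
  have hm0 : (0:ℝ) < m := by linarith
  have hx0 : 0 ≤ x := le_trans (by positivity) hx
  have hy0 : 0 ≤ y := by linarith
  have hau : IsUnit (a : ZMod m) := by
    exact (ZMod.coe_int_isUnit_iff_isCoprime a m).2 (Int.isCoprime_iff_gcd_eq_one.2 (by rwa [Int.gcd_comm]))
  obtain ⟨W, hW, hT⟩ := T2_eq m hm a x y hx0 hxm hy0
  obtain ⟨hPx, hmt⟩ := main_term m hm x y hx0 hxm hy0 hym
  have hc := core_bound m W (a : ZMod m) hau ⌊y⌋₊
  rw [← hT, hW] at hc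
  have hd := hdiv m (by omega)
  set E : ℝ := (m:ℝ)^(ε/2) with hE
  have hE1 : 1 ≤ E := Real.one_le_rpow hm1 (by positivity)
  have hlog : 1 + Real.log m ≤ (1 + 2/ε) * E := by
    have := Real.log_le_rpow_div hm0.le (half_pos hε)
    calc 1 + Real.log m ≤ E + E / (ε/2) := by linarith
      _ = _ := by field_simp
  have hR : (m:ℝ)^((1:ℝ)/2 + ε) = Real.sqrt m * (E * E) := by
    rw [Real.sqrt_eq_rpow, hE, ← Real.rpow_add hm0, ← Real.rpow_add hm0]
    congr 1; ring
  have hs1 : 1 ≤ Real.sqrt m := Real.one_le_sqrt.2 hm1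
  have hl0 : 0 ≤ 1 + Real.log m := by
    have := Real.log_nonneg hm1; linarith
  have b1 : (goodPrimes m x).card * Real.sqrt m * (m.divisors.card * (1 + Real.log m))
      ≤ x * Real.sqrt m * ((K * E) * ((1 + 2/ε) * E)) := by gcongr
  have hF : 1 ≤ Real.sqrt m * (E * E) := one_le_mul_of_one_le_of_one_le hs1
    (one_le_mul_of_one_le_of_one_le hE1 hE1)
  have hF2 : E ≤ Real.sqrt m * (E * E) := by
    have : 1 * E ≤ (Real.sqrt m * E) * E := by
      gcongr; exact one_le_mul_of_one_le_of_one_le hs1 hE1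
    linarith
  have b2 : x * (1 + 2 * (m.divisors.card : ℝ)) ≤
      x * (Real.sqrt m * (E * E) + 2 * (K * (Real.sqrt m * (E * E)))) := by
    gcongr
    exact hd.trans (by gcongr)
  rw [hR]
  calc _ ≤ _ := abs_sub_le _ _ _
    _ ≤ _ := add_le_add (hc.trans b1) (hmt.trans b2)
    _ = _ := by ring
end

section
/- For every ε > 0 there exists a constant C = C(ε) > 0 such that for all integers m ≥ 2, all reals x, y with m ≥ x ≥ m^{1/2} and m ≥ y ≥ 1, and every integer a with gcd(a,m) = 1, the quantity T₃(a;x,y), the number of quadruples (p₁, p₂, p₃, v) with p₁, p₂, p₃ primes ≤ x coprime to m, v an integer with 1 ≤ v ≤ y, and a·p₁⁻¹·p₂⁻¹·p₃⁻¹ ≡ v (mod m), satisfies |T₃(a;x,y) − π(x)³·y/m| ≤ C·x^{5/2+ε}. -/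
/-- `T₃(a; x, y)`: the number of quadruples `(p₁, p₂, p₃, v)` with `p₁, p₂, p₃` primes at
most `x` coprime to `m`, `1 ≤ v ≤ y`, and `a · p₁⁻¹ · p₂⁻¹ · p₃⁻¹ ≡ v (mod m)`. -/
noncomputable def T3 (m : ℕ) (a : ℤ) (x y : ℝ) : ℕ :=
  {t : ℕ × ℕ × ℕ × ℕ | t.1.Prime ∧ t.2.1.Prime ∧ t.2.2.1.Prime ∧
    (t.1 : ℝ) ≤ x ∧ (t.2.1 : ℝ) ≤ x ∧ (t.2.2.1 : ℝ) ≤ x ∧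
    Nat.Coprime t.1 m ∧ Nat.Coprime t.2.1 m ∧ Nat.Coprime t.2.2.1 m ∧
    1 ≤ t.2.2.2 ∧ (t.2.2.2 : ℝ) ≤ y ∧
    a * (minv m t.1 : ℤ) * (minv m t.2.1 : ℤ) * (minv m t.2.2.1 : ℤ)
      ≡ (t.2.2.2 : ℤ) [ZMOD (m : ℤ)]}.ncard


namespace Aux13
open Finset

noncomputable def vv {m : ℕ} (k : ZMod m) : ℝ := 1 / (k.val : ℝ)
noncomputable def ww {m : ℕ} (k : ZMod m) : ℝ := vv k + vv (-k)

lemma vv_nonneg {m : ℕ} (k : ZMod m) : 0 ≤ vv k := by unfold vv; positivity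
lemma ww_nonneg {m : ℕ} (k : ZMod m) : 0 ≤ ww k := add_nonneg (vv_nonneg _) (vv_nonneg _)

lemma sum_vv {m : ℕ} [NeZero m] (d : ℕ) (hd : 0 < d) :
    ∑ k : ZMod m with d ∣ k.val, vv k ≤ (1 + Real.log m) / d := by
  have hm : 0 < m := Nat.pos_of_ne_zero (NeZero.ne m)
  have h1 : ∑ k : ZMod m with d ∣ k.val, vv k =
      ∑ k : ZMod m with d ∣ k.val ∧ k ≠ 0, vv k := by
    symm
    apply Finset.sum_subset
    · intro k; simp; tauto
    · intro k hk hk2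
      simp at hk hk2
      simp [vv, hk2 hk]
  have hval : ∀ k ∈ (univ.filter (fun k : ZMod m => d ∣ k.val ∧ k ≠ 0)),
      d * (k.val / d) = k.val := by
    intro k hk; simp at hk; exact Nat.mul_div_cancel' hk.1
  have h2 : ∑ k : ZMod m with d ∣ k.val ∧ k ≠ 0, vv k =
      ∑ j ∈ (univ.filter (fun k : ZMod m => d ∣ k.val ∧ k ≠ 0)).image (fun k => k.val / d),
        1 / ((d : ℝ) * j) := by
    rw [Finset.sum_image]
    · apply Finset.sum_congr rfl
      intro k hk
      have := hval k hk
      unfold vv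
      rw [← this]; push_cast
      rw [this]
    · intro k hk l hl h
      simp only at h
      have a := hval k (by simpa using hk)
      have b := hval l (by simpa using hl)
      apply ZMod.val_injective m
      rw [← a, ← b, h]
  rw [h1, h2]
  have h3 : (univ.filter (fun k : ZMod m => d ∣ k.val ∧ k ≠ 0)).image (fun k => k.val / d)
      ⊆ Finset.Icc 1 m := by
    intro j hj
    obtain ⟨k, hk, rfl⟩ := Finset.mem_image.1 hj
    have a := hval k hk
    simp at hk
    have : k.val ≠ 0 := by simpa using hk.2
    have h4 : k.val < m := ZMod.val_lt k
    rw [Finset.mem_Icc]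
    constructor
    · rcases Nat.eq_zero_or_pos (k.val / d) with h | h
      · rw [h] at a; omega
      · exact h
    · exact (Nat.div_le_self _ _).trans h4.le
  refine (Finset.sum_le_sum_of_subset_of_nonneg h3 (fun _ _ _ => by positivity)).trans ?_
  have h5 := harmonic_le_one_add_log m
  rw [harmonic_eq_sum_Icc] at h5
  push_cast at h5
  calc _ = (∑ j ∈ Finset.Icc 1 m, (j : ℝ)⁻¹) / d := by
        rw [Finset.sum_div]; apply Finset.sum_congr rfl; intro j hj
        rw [one_div, mul_inv]; ring
    _ ≤ _ := by gcongr

lemma dvd_neg_val {m : ℕ} [NeZero m] {d : ℕ} (hd : d ∣ m) (k : ZMod m) :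
    d ∣ (-k).val ↔ d ∣ k.val := by
  have h : ∀ k : ZMod m, d ∣ k.val → d ∣ (-k).val := by
    intro k hk
    rw [ZMod.neg_val]
    split_ifs
    · simp
    · exact Nat.dvd_sub hd hk
  exact ⟨fun h1 => by simpa using h _ h1, h k⟩

lemma sum_ww {m : ℕ} [NeZero m] (d : ℕ) (hd : 0 < d) (hdm : d ∣ m) :
    ∑ k : ZMod m with d ∣ k.val, ww k ≤ 2 * (1 + Real.log m) / d := by
  unfold ww
  rw [Finset.sum_add_distrib]
  have : ∑ k : ZMod m with d ∣ k.val, vv (-k) = ∑ k : ZMod m with d ∣ k.val, vv k := by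
    apply Finset.sum_equiv (Equiv.neg (ZMod m))
    · intro k; simp [dvd_neg_val hdm]
    · intro k _; rfl
  rw [this]
  have := sum_vv (m := m) d hd
  have e : 2 * (1 + Real.log m) / d = (1 + Real.log m) / d + (1 + Real.log m) / d := by ring
  rw [e]; linarith

/-- number of solutions of `k t = c`. -/
lemma card_sol {m : ℕ} [NeZero m] (k c : ZMod m) :
    (univ.filter (fun t : ZMod m => k * t = c)).card ≤ Nat.gcd k.val m := by
  have hm : 0 < m := Nat.pos_of_ne_zero (NeZero.ne m)
  set g := Nat.gcd k.val m with hg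
  have hgp : 0 < g := Nat.gcd_pos_of_pos_right _ hm
  have hgm : g ∣ m := Nat.gcd_dvd_right _ _
  have hpos : 0 < m / g := Nat.div_pos (Nat.le_of_dvd hm hgm) hgp
  rw [← Finset.card_range g]
  apply Finset.card_le_card_of_injOn (fun t => t.val / (m / g))
  · intro t _
    simp only [coe_range, Set.mem_Iio]
    rw [Nat.div_lt_iff_lt_mul hpos, Nat.mul_div_cancel' hgm]
    exact ZMod.val_lt t
  · intro s hs t ht h
    simp only [coe_filter, Finset.mem_univ, true_and, Set.mem_ofPred_eq] at hs ht
    have h1 : k.val * s.val ≡ k.val * t.val [MOD m] := by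
      rw [← ZMod.natCast_eq_natCast_iff]
      push_cast
      simp [hs, ht]
    have h2 := Nat.ModEq.cancel_left_div_gcd hm h1
    rw [Nat.gcd_comm, ← hg] at h2
    apply ZMod.val_injective m
    unfold Nat.ModEq at h2
    rw [← Nat.div_add_mod s.val (m / g), ← Nat.div_add_mod t.val (m / g), h2]
    simp only at h
    rw [h]

lemma gcd_eq {m : ℕ} [NeZero m] (h k s t : ZMod m) (hs : IsUnit s) (ht : IsUnit t)
    (e : h * s = k * t) : Nat.gcd h.val m = Nat.gcd k.val m := by
  have key : ∀ h s : ZMod m, IsUnit s → Nat.gcd (h * s).val m = Nat.gcd h.val m := by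
    intro h s hs
    obtain ⟨u, rfl⟩ := hs
    rw [ZMod.val_mul, ← Nat.gcd_rec, Nat.gcd_comm]
    have := ZMod.val_coe_unit_coprime u
    exact Nat.Coprime.gcd_mul_right_cancel _ this
  rw [← key h s hs, e, key k t ht]

lemma quad {m : ℕ} [NeZero m] (S : Finset (ZMod m)) (hS : ∀ s ∈ S, IsUnit s) :
    ∑ h : ZMod m, ∑ s ∈ S, ∑ k : ZMod m, ∑ t ∈ S,
      (if h * s = k * t then ww h * ww k else 0) ≤ 4 * (1 + Real.log m) ^ 2 * S.card := by
  have hm : 0 < m := Nat.pos_of_ne_zero (NeZero.ne m)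
  have hL : 0 ≤ 1 + Real.log m := by
    have : 0 ≤ Real.log m := Real.log_natCast_nonneg m
    linarith
  have step : ∀ h : ZMod m, ∀ s ∈ S, ∑ k : ZMod m, ∑ t ∈ S,
      (if h * s = k * t then ww h * ww k else 0) ≤ ww h * (2 * (1 + Real.log m)) := by
    intro h s hs
    set g := Nat.gcd h.val m with hg
    have hgp : 0 < g := Nat.gcd_pos_of_pos_right _ hm
    have hgm : g ∣ m := Nat.gcd_dvd_right _ _
    have h1 : ∀ k : ZMod m, ∑ t ∈ S, (if h * s = k * t then ww h * ww k else 0) ≤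
        if g ∣ k.val then ww h * (g * ww k) else 0 := by
      intro k
      by_cases hk : Nat.gcd k.val m = g
      · rw [if_pos (hk ▸ Nat.gcd_dvd_left _ _), ← Finset.sum_filter, Finset.sum_const, nsmul_eq_mul]
        have : (#{t ∈ S | h * s = k * t} : ℝ) ≤ g := by
          have h2 := card_sol k (h * s)
          rw [hk] at h2
          exact_mod_cast (Finset.card_le_card (by
            intro t ht; simp at ht ⊢; exact ht.2.symm)).trans h2
        have h3 := mul_nonneg (ww_nonneg h) (ww_nonneg k)
        nlinarith
      · rw [Finset.sum_eq_zero]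
        · split_ifs
          · have := ww_nonneg h
            have := ww_nonneg k
            positivity
          · exact le_rfl
        · intro t ht
          rw [if_neg]
          intro e
          exact hk (gcd_eq h k s t (hS s hs) (hS t ht) e).symm
    refine (Finset.sum_le_sum (fun k _ => h1 k)).trans ?_
    rw [← Finset.sum_filter, ← Finset.mul_sum, ← Finset.mul_sum]
    apply mul_le_mul_of_nonneg_left _ (ww_nonneg h)
    have := sum_ww (m := m) g hgp hgm
    have hg' : (0 : ℝ) < g := by exact_mod_cast hgp
    rw [le_div_iff₀ hg'] at this
    linarith
  have hall := sum_ww (m := m) 1 one_pos (one_dvd _)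
  simp at hall
  calc _ ≤ ∑ h : ZMod m, ∑ s ∈ S, ww h * (2 * (1 + Real.log m)) :=
        Finset.sum_le_sum (fun h _ => Finset.sum_le_sum (fun s hs => step h s hs))
    _ = (∑ h : ZMod m, ww h) * (2 * (1 + Real.log m)) * S.card := by
        simp only [Finset.sum_const, nsmul_eq_mul]
        rw [← Finset.mul_sum, ← Finset.sum_mul]; ring
    _ ≤ (2 * (1 + Real.log m)) * (2 * (1 + Real.log m)) * S.card := by gcongr
    _ = _ := by ring

lemma largeSieve {m : ℕ} [NeZero m] (S : Finset (ZMod m)) (hS : ∀ s ∈ S, IsUnit s)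
    (c : ZMod m → ℂ) (hc : ∀ h, ‖c h‖ ≤ ww h) :
    ∑ u : ZMod m, ‖∑ s ∈ S, ∑ h : ZMod m, c h * ZMod.stdAddChar (h * (u * s))‖ ^ 2
      ≤ m * (4 * (1 + Real.log m) ^ 2 * S.card) := by
  have e : ∀ u : ZMod m,
     ((‖∑ s ∈ S, ∑ h : ZMod m, c h * ZMod.stdAddChar (h * (u * s))‖ ^ 2 : ℝ) : ℂ)
      = ∑ h : ZMod m, ∑ s ∈ S, ∑ k : ZMod m, ∑ t ∈ S,
        c h * (starRingEnd ℂ) (c k) * ZMod.stdAddChar (u * (h * s - k * t)) := by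
    intro u
    push_cast
    rw [← Complex.mul_conj', Finset.sum_comm, map_sum, Finset.sum_mul]
    refine Finset.sum_congr rfl fun h _ => ?_
    rw [Finset.sum_mul]
    refine Finset.sum_congr rfl fun s _ => ?_
    rw [Finset.mul_sum]
    refine Finset.sum_congr rfl fun k _ => ?_
    rw [map_sum, Finset.mul_sum]
    refine Finset.sum_congr rfl fun t _ => ?_
    rw [map_mul (starRingEnd ℂ), ← AddChar.map_neg_eq_conj]
    have : u * (h * s - k * t) = h * (u * s) + -(k * (u * t)) := by ring
    rw [this, AddChar.map_add_eq_mul]; ring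
  have e2 : ((∑ u : ZMod m,
      ‖∑ s ∈ S, ∑ h : ZMod m, c h * ZMod.stdAddChar (h * (u * s))‖ ^ 2 : ℝ) : ℂ)
      = ∑ h : ZMod m, ∑ s ∈ S, ∑ k : ZMod m, ∑ t ∈ S,
        (if h * s = k * t then (m : ℂ) * (c h * (starRingEnd ℂ) (c k)) else 0) := by
    push_cast
    push_cast at e
    rw [Finset.sum_congr rfl (fun u _ => e u), Finset.sum_comm]
    refine Finset.sum_congr rfl fun h _ => ?_
    rw [Finset.sum_comm]
    refine Finset.sum_congr rfl fun s _ => ?_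
    rw [Finset.sum_comm]
    refine Finset.sum_congr rfl fun k _ => ?_
    rw [Finset.sum_comm]
    refine Finset.sum_congr rfl fun t _ => ?_
    rw [← Finset.mul_sum, AddChar.sum_mulShift _ (ZMod.isPrimitive_stdAddChar m)]
    simp only [sub_eq_zero, ZMod.card]
    split_ifs <;> simp [mul_comm]
  have e3 : ∑ u : ZMod m,
      ‖∑ s ∈ S, ∑ h : ZMod m, c h * ZMod.stdAddChar (h * (u * s))‖ ^ 2 ≤
      ∑ h : ZMod m, ∑ s ∈ S, ∑ k : ZMod m, ∑ t ∈ S,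
        (m : ℝ) * (if h * s = k * t then (ww h * ww k) else 0) := by
    refine (le_abs_self _).trans ?_
    rw [← Real.norm_eq_abs, ← Complex.norm_real, e2]
    refine (norm_sum_le _ _).trans (Finset.sum_le_sum fun h _ => ?_)
    refine (norm_sum_le _ _).trans (Finset.sum_le_sum fun s _ => ?_)
    refine (norm_sum_le _ _).trans (Finset.sum_le_sum fun k _ => ?_)
    refine (norm_sum_le _ _).trans (Finset.sum_le_sum fun t _ => ?_)
    split_ifs
    · simp only [norm_mul, Complex.norm_natCast, RCLike.norm_conj]
      have := ww_nonneg h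
      gcongr
      · exact hc h
      · exact hc k
    · simp
  refine e3.trans ?_
  simp only [← Finset.mul_sum]
  exact mul_le_mul_of_nonneg_left (quad S hS) (by positivity)

lemma norm_char_sub_one {m : ℕ} [NeZero m] (h : ZMod m) (hh : h ≠ 0) :
    4 / (m * ww h) ≤ ‖(ZMod.stdAddChar h : ℂ) - 1‖ := by
  have hm : 0 < m := Nat.pos_of_ne_zero (NeZero.ne m)
  have hmR : (0 : ℝ) < m := by exact_mod_cast hm
  have h0 : 0 < h.val := Nat.pos_of_ne_zero (by simpa using hh)
  have hlt : h.val < m := ZMod.val_lt h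
  have h0R : (0 : ℝ) < h.val := by exact_mod_cast h0
  have hltR : (h.val : ℝ) < m := by exact_mod_cast hlt
  have e : (ZMod.stdAddChar h : ℂ) = Complex.exp (Complex.I * ((2 * Real.pi * h.val / m : ℝ) : ℂ)) := by
    rw [ZMod.stdAddChar_apply, ZMod.toCircle_apply]
    congr 1; push_cast; ring
  rw [e, Complex.norm_exp_I_mul_ofReal_sub_one]
  have hneg : ((-h).val : ℝ) = m - h.val := by
    rw [ZMod.neg_val, if_neg hh, Nat.cast_sub hlt.le]
  have hw : ww h = m / (h.val * (m - h.val)) := by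
    unfold ww vv
    rw [hneg]
    have : (m : ℝ) - h.val ≠ 0 := by linarith
    field_simp
    ring
  rw [hw]
  have hpi := Real.pi_pos
  have e2 : 2 * Real.pi * h.val / m / 2 = Real.pi * h.val / m := by ring
  rw [e2]
  have goal1 : 4 / (m * ((m : ℝ) / (h.val * (m - h.val)))) = 4 * (h.val / m) * ((m - h.val) / m) := by
    have : (m : ℝ) - h.val ≠ 0 := by linarith
    field_simp
  rw [goal1, norm_mul]
  have hfrac : (0 : ℝ) < h.val / m := by positivity
  have hfrac1 : ((m : ℝ) - h.val) / m = 1 - h.val / m := by field_simp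
  have hfrac2 : (h.val : ℝ) / m < 1 := by rw [div_lt_one hmR]; exact hltR
  rw [hfrac1, mul_div_assoc]
  set r : ℝ := h.val / m
  simp only [Real.norm_eq_abs, abs_two]
  have hs : 2 * r * (1 - r) ≤ Real.sin (Real.pi * r) := by
    by_cases hr : r ≤ 1 / 2
    · have := Real.mul_le_sin (x := Real.pi * r) (by positivity) (by nlinarith)
      have e3 : 2 / Real.pi * (Real.pi * r) = 2 * r := by field_simp
      rw [e3] at this
      nlinarith
    · push Not at hr
      have := Real.mul_le_sin (x := Real.pi * (1 - r)) (mul_nonneg hpi.le (by linarith)) (by nlinarith)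
      have e3 : 2 / Real.pi * (Real.pi * (1 - r)) = 2 * (1 - r) := by field_simp
      have e4 : Real.pi * (1 - r) = Real.pi - Real.pi * r := by ring
      rw [e3, e4, Real.sin_pi_sub] at this
      nlinarith
  have := le_abs_self (Real.sin (Real.pi * r))
  linarith

lemma ww_pos {m : ℕ} [NeZero m] (h : ZMod m) (hh : h ≠ 0) : 0 < ww h := by
  have h0 : 0 < h.val := Nat.pos_of_ne_zero (by simpa using hh)
  have : 0 < vv h := by unfold vv; positivity
  have := vv_nonneg (-h)
  unfold ww; linarith

lemma fourier {m : ℕ} [NeZero m] (Y : ℕ) :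
    ∃ c : ZMod m → ℂ, (∀ h, ‖c h‖ ≤ ww h) ∧ ∀ r : ZMod m,
      (∑ v ∈ Finset.Icc 1 Y, if r = (v : ZMod m) then (1 : ℂ) else 0) - (Y : ℂ) / m =
        ∑ h : ZMod m, c h * ZMod.stdAddChar (h * r) := by
  have hm : 0 < m := Nat.pos_of_ne_zero (NeZero.ne m)
  have hmR : (0 : ℝ) < m := by exact_mod_cast hm
  have hmC : (m : ℂ) ≠ 0 := by exact_mod_cast hm.ne'
  set F : ZMod m → ℂ := fun h => (1 / m : ℂ) * ∑ v ∈ Finset.Icc 1 Y, ZMod.stdAddChar (h * -(v : ZMod m))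
    with hF
  refine ⟨fun h => if h = 0 then 0 else F h, ?_, ?_⟩
  · intro h
    simp only
    split_ifs with hh
    · simpa using ww_nonneg h
    · set z : ℂ := ZMod.stdAddChar (-h) with hz
      have hz1 := norm_char_sub_one (-h) (neg_ne_zero.2 hh)
      have hww : ww (-h) = ww h := by unfold ww; rw [neg_neg, add_comm]
      rw [hww, ← hz] at hz1
      have hwp := ww_pos h hh
      have hpos : 0 < ‖z - 1‖ := lt_of_lt_of_le (by positivity) hz1
      have hne : z ≠ 1 := by
        intro h1; rw [h1] at hpos; simp at hpos
      have hzn : ‖z‖ = 1 := by rw [hz]; simp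
      have hsum : ∑ v ∈ Finset.Icc 1 Y, (ZMod.stdAddChar (h * -(v : ZMod m)) : ℂ)
          = z * ((z ^ Y - 1) / (z - 1)) := by
        rw [← geom_sum_eq hne, Finset.mul_sum, Finset.sum_bij (fun v _ => v - 1)]
        · intro v hv; simp at hv ⊢; omega
        · intro a ha b hb; simp at ha hb; omega
        · intro b hb; simp at hb; exact ⟨b + 1, by simp; omega, by simp⟩
        · intro v hv
          simp at hv
          rw [← pow_succ', Nat.sub_add_cancel hv.1, hz, ← AddChar.map_nsmul_eq_pow]
          congr 1; simp; ring
      rw [hF]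
      simp only
      rw [hsum, norm_mul, norm_mul, norm_div (z ^ Y - 1), hzn]
      have hnum : ‖z ^ Y - 1‖ ≤ 2 := by
        refine (norm_sub_le _ _).trans ?_
        rw [norm_pow, hzn]; norm_num
      have hinv : 1 / ‖z - 1‖ ≤ m * ww h / 4 := by
        rw [div_le_iff₀ (by positivity)] at hz1
        rw [div_le_iff₀ hpos]; linarith
      have hn1 : ‖(1 / m : ℂ)‖ = 1 / m := by simp
      rw [hn1]
      calc 1 / (m : ℝ) * (1 * (‖z ^ Y - 1‖ / ‖z - 1‖))
          = 1 / (m : ℝ) * (‖z ^ Y - 1‖ * (1 / ‖z - 1‖)) := by ring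
        _ ≤ 1 / (m : ℝ) * (2 * (m * ww h / 4)) := by gcongr
        _ = ww h / 2 := by field_simp; norm_num
        _ ≤ ww h := by linarith
  · intro r
    have h1 : ∑ h : ZMod m, F h * ZMod.stdAddChar (h * r) =
        ∑ v ∈ Finset.Icc 1 Y, if r = (v : ZMod m) then (1 : ℂ) else 0 := by
      simp only [hF, Finset.mul_sum, Finset.sum_mul]
      rw [Finset.sum_comm]
      refine Finset.sum_congr rfl fun v _ => ?_
      have : ∀ h : ZMod m, 1 / (m : ℂ) * ZMod.stdAddChar (h * -(v : ZMod m)) * ZMod.stdAddChar (h * r)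
          = 1 / (m : ℂ) * ZMod.stdAddChar (h * (r - (v : ZMod m))) := by
        intro h
        rw [mul_assoc, ← AddChar.map_add_eq_mul]; congr 2; ring
      simp only [this]
      rw [← Finset.mul_sum, AddChar.sum_mulShift _ (ZMod.isPrimitive_stdAddChar m)]
      simp only [sub_eq_zero, ZMod.card]
      split_ifs
      · field_simp
      · simp
    rw [← h1]
    have h2 : ∀ h : ZMod m, (if h = 0 then 0 else F h) * (ZMod.stdAddChar (h * r) : ℂ) =
        F h * ZMod.stdAddChar (h * r) - if h = 0 then (Y : ℂ) / m else 0 := by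
      intro h
      split_ifs with hh
      · subst hh; simp [hF]; ring
      · ring
    simp only [h2]
    rw [Finset.sum_sub_distrib]; simp

lemma alpha_bound {m : ℕ} [NeZero m] (N : ℕ) (P : Finset ℕ)
    (hP : ∀ p ∈ P, p.Prime ∧ p ≤ N) (c : ZMod m) :
    #{q ∈ P ×ˢ P | (q.1 : ZMod m) * q.2 = c} ≤ 2 * (N ^ 2 / m + 1) := by
  set A := {q ∈ P ×ˢ P | (q.1 : ZMod m) * q.2 = c} with hA
  have h1 : #A ≤ 2 * #(A.image (fun q => q.1 * q.2)) := by
    apply Finset.card_le_mul_card_image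
    intro n hn
    obtain ⟨q, hq, rfl⟩ := Finset.mem_image.1 hn
    have : {a ∈ A | a.1 * a.2 = q.1 * q.2} ⊆ {(q.1, q.2), (q.2, q.1)} := by
      rintro ⟨a, b⟩ hab
      simp [hA] at hab hq
      obtain ⟨⟨⟨ha, hb⟩, -⟩, e⟩ := hab
      have pa := (hP a ha).1
      have pb := (hP b hb).1
      have p1 := (hP _ hq.1.1).1
      have p2 := (hP _ hq.1.2).1
      have : a ∣ q.1 * q.2 := ⟨b, e.symm⟩
      simp only [Finset.mem_insert, Finset.mem_singleton, Prod.mk.injEq]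
      rcases (Nat.Prime.dvd_mul pa).1 this with h | h
      · have h3 := (Nat.prime_dvd_prime_iff_eq pa p1).1 h
        left; refine ⟨h3, ?_⟩
        rw [← h3] at e
        exact Nat.eq_of_mul_eq_mul_left pa.pos e
      · have h3 := (Nat.prime_dvd_prime_iff_eq pa p2).1 h
        right; refine ⟨h3, ?_⟩
        rw [← h3, mul_comm q.1] at e
        exact Nat.eq_of_mul_eq_mul_left pa.pos e
    exact (Finset.card_le_card this).trans Finset.card_le_two
  have h2 : #(A.image (fun q => q.1 * q.2)) ≤ N ^ 2 / m + 1 := by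
    rw [← Finset.card_range (N ^ 2 / m + 1)]
    have hmem : ∀ n ∈ A.image (fun q => q.1 * q.2), n ≤ N ^ 2 ∧ (n : ZMod m) = c := by
      intro n hn
      obtain ⟨q, hq, rfl⟩ := Finset.mem_image.1 hn
      simp [hA] at hq
      refine ⟨?_, by push_cast; exact hq.2⟩
      rw [pow_two]
      exact Nat.mul_le_mul (hP _ hq.1.1).2 (hP _ hq.1.2).2
    apply Finset.card_le_card_of_injOn (fun n => n / m)
    · intro n hn
      have := Nat.div_le_div_right (c := m) (hmem n hn).1
      simp; omega
    · intro n hn n' hn' h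
      have e : (n : ZMod m) = n' := by rw [(hmem n hn).2, (hmem n' hn').2]
      rw [ZMod.natCast_eq_natCast_iff] at e
      unfold Nat.ModEq at e
      simp only at h
      rw [← Nat.div_add_mod n m, ← Nat.div_add_mod n' m, h, e]
  omega

lemma core {m : ℕ} [NeZero m] (N Y : ℕ) (P : Finset ℕ)
    (hP : ∀ p ∈ P, p.Prime ∧ p ≤ N ∧ Nat.Coprime p m ∧ p < m) (a : ZMod m) (ha : IsUnit a) :
    |∑ p ∈ P, ∑ q ∈ P, ∑ r ∈ P, ((∑ v ∈ Finset.Icc 1 Y,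
      if a * (p : ZMod m)⁻¹ * (q : ZMod m)⁻¹ * (r : ZMod m)⁻¹ = (v : ZMod m) then (1 : ℝ) else 0)
        - (Y : ℝ) / m)| ^ 2 ≤
    ((2 * (N ^ 2 / m + 1) : ℕ) * (P.card : ℝ) ^ 2) * (m * (4 * (1 + Real.log m) ^ 2 * P.card)) := by
  obtain ⟨c, hc, hf⟩ := fourier (m := m) Y
  have hinv : ∀ p ∈ P, (p : ZMod m) * (p : ZMod m)⁻¹ = 1 := fun p hp =>
    ZMod.coe_mul_inv_eq_one p (hP p hp).2.2.1
  have hinj : Set.InjOn (fun p : ℕ => (p : ZMod m)⁻¹) P := by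
    intro p hp q hq h
    simp only at h
    have h1 := hinv p hp
    have h2 := hinv q hq
    have h3 : (p : ZMod m) = q := by
      calc (p : ZMod m) = p * (q * (q : ZMod m)⁻¹) := by rw [h2, mul_one]
        _ = q * (p * (p : ZMod m)⁻¹) := by rw [h]; ring
        _ = q := by rw [h1, mul_one]
    rw [ZMod.natCast_eq_natCast_iff] at h3
    exact h3.eq_of_lt_of_lt (hP p hp).2.2.2 (hP q hq).2.2.2
  set S := P.image (fun p : ℕ => (p : ZMod m)⁻¹) with hS
  have hSc : S.card = P.card := Finset.card_image_of_injOn hinj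
  have hSu : ∀ s ∈ S, IsUnit s := by
    intro s hs
    obtain ⟨p, hp, rfl⟩ := Finset.mem_image.1 hs
    exact IsUnit.of_mul_eq_one (p : ZMod m) (by rw [mul_comm]; exact hinv p hp)
  have hLS := largeSieve S hSu c hc
  set f : ZMod m → ℝ := fun r => (∑ v ∈ Finset.Icc 1 Y,
      if r = (v : ZMod m) then (1 : ℝ) else 0) - (Y : ℝ) / m with hfdef
  have hfc : ∀ r, ((f r : ℝ) : ℂ) = ∑ h : ZMod m, c h * ZMod.stdAddChar (h * r) := by
    intro r
    rw [← hf r, hfdef]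
    push_cast
    congr 1
    refine Finset.sum_congr rfl fun v _ => ?_
    split_ifs <;> simp
  set G : ZMod m → ℝ := fun u => ∑ s ∈ S, f (u * s) with hG
  have hGn : ∀ u, ‖∑ s ∈ S, ∑ h : ZMod m, c h * ZMod.stdAddChar (h * (u * s))‖ ^ 2 = G u ^ 2 := by
    intro u
    simp only [← hfc]
    rw [← Complex.ofReal_sum, Complex.norm_real, Real.norm_eq_abs, sq_abs]
  simp only [hGn, hSc] at hLS
  set α : ZMod m → ℕ := fun u =>
    #{q ∈ P ×ˢ P | a * (q.1 : ZMod m)⁻¹ * (q.2 : ZMod m)⁻¹ = u} with hα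
  have hsum : ∑ p ∈ P, ∑ q ∈ P, ∑ r ∈ P, ((∑ v ∈ Finset.Icc 1 Y,
      if a * (p : ZMod m)⁻¹ * (q : ZMod m)⁻¹ * (r : ZMod m)⁻¹ = (v : ZMod m) then (1 : ℝ) else 0)
        - (Y : ℝ) / m) = ∑ u : ZMod m, (α u : ℝ) * G u := by
    have h1 : ∀ p q : ℕ, ∑ r ∈ P, ((∑ v ∈ Finset.Icc 1 Y,
      if a * (p : ZMod m)⁻¹ * (q : ZMod m)⁻¹ * (r : ZMod m)⁻¹ = (v : ZMod m) then (1 : ℝ) else 0)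
        - (Y : ℝ) / m) = G (a * (p : ZMod m)⁻¹ * (q : ZMod m)⁻¹) := by
      intro p q
      rw [hG]; simp only
      rw [hS, Finset.sum_image hinj]
    simp only [h1]
    rw [← Finset.sum_product' (f := fun p q : ℕ => G (a * (p : ZMod m)⁻¹ * (q : ZMod m)⁻¹)),
      ← Finset.sum_fiberwise (s := P ×ˢ P)
        (g := fun q : ℕ × ℕ => a * (q.1 : ZMod m)⁻¹ * (q.2 : ZMod m)⁻¹)]
    refine Finset.sum_congr rfl fun u _ => ?_
    rw [Finset.sum_congr rfl (g := fun _ => G u)]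
    · rw [Finset.sum_const, nsmul_eq_mul]
    · intro q hq
      rw [(Finset.mem_filter.1 hq).2]
  rw [hsum, sq_abs]
  refine (Finset.sum_mul_sq_le_sq_mul_sq _ _ _).trans ?_
  have hαsum : ∑ u : ZMod m, (α u : ℝ) = (P.card : ℝ) ^ 2 := by
    have := Finset.card_eq_sum_card_fiberwise (s := P ×ˢ P) (t := (Finset.univ : Finset (ZMod m)))
      (f := fun q : ℕ × ℕ => a * (q.1 : ZMod m)⁻¹ * (q.2 : ZMod m)⁻¹) (fun _ _ => by simp)
    rw [Finset.card_product] at this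
    rw [pow_two]
    exact_mod_cast this.symm
  have hαb : ∀ u, α u ≤ 2 * (N ^ 2 / m + 1) := by
    intro u
    by_cases hu : IsUnit u
    · refine le_trans (Finset.card_le_card ?_)
        (alpha_bound (m := m) N P (fun p hp => ⟨(hP p hp).1, (hP p hp).2.1⟩) (a * u⁻¹))
      intro q hq
      simp only [Finset.mem_filter, Finset.mem_product] at hq ⊢
      refine ⟨hq.1, ?_⟩
      have h1 := hinv _ hq.1.1
      have h2 := hinv _ hq.1.2
      have h3 : u * u⁻¹ = 1 := ZMod.mul_inv_of_unit u hu
      have h4 := hq.2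
      calc (q.1 : ZMod m) * q.2 = (q.1 * q.2) * (u * u⁻¹) := by rw [h3, mul_one]
        _ = (q.1 * q.2) * ((a * (q.1 : ZMod m)⁻¹ * (q.2 : ZMod m)⁻¹) * u⁻¹) := by rw [h4]
        _ = (q.1 * (q.1 : ZMod m)⁻¹) * (q.2 * (q.2 : ZMod m)⁻¹) * (a * u⁻¹) := by ring
        _ = a * u⁻¹ := by rw [h1, h2]; ring
    · have : α u = 0 := by
        rw [hα]; simp only
        rw [Finset.card_eq_zero, Finset.filter_eq_empty_iff]
        intro q hq e
        rw [Finset.mem_product] at hq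
        apply hu
        rw [← e]
        exact (ha.mul (hSu _ (Finset.mem_image_of_mem _ hq.1))).mul
          (hSu _ (Finset.mem_image_of_mem _ hq.2))
      omega
  have hα2 : ∑ u : ZMod m, (α u : ℝ) ^ 2 ≤ (2 * (N ^ 2 / m + 1) : ℕ) * (P.card : ℝ) ^ 2 := by
    rw [← hαsum, Finset.mul_sum]
    refine Finset.sum_le_sum fun u _ => ?_
    rw [pow_two]
    have : (α u : ℝ) ≤ (2 * (N ^ 2 / m + 1) : ℕ) := by exact_mod_cast hαb u
    exact mul_le_mul_of_nonneg_right this (by positivity)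
  exact mul_le_mul hα2 hLS (Finset.sum_nonneg fun _ _ => by positivity) (by positivity)

lemma T3_eq (m : ℕ) [NeZero m] (a : ℤ) (x y : ℝ) (hx : 0 ≤ x) (hy : 0 ≤ y) :
    (T3 m a x y : ℝ) = ∑ p ∈ (Finset.Icc 1 ⌊x⌋₊).filter (fun p => p.Prime ∧ Nat.Coprime p m),
      ∑ q ∈ (Finset.Icc 1 ⌊x⌋₊).filter (fun p => p.Prime ∧ Nat.Coprime p m),
      ∑ r ∈ (Finset.Icc 1 ⌊x⌋₊).filter (fun p => p.Prime ∧ Nat.Coprime p m),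
      ∑ v ∈ Finset.Icc 1 ⌊y⌋₊,
      if (a : ZMod m) * (p : ZMod m)⁻¹ * (q : ZMod m)⁻¹ * (r : ZMod m)⁻¹ = (v : ZMod m)
        then (1 : ℝ) else 0 := by
  set P := (Finset.Icc 1 ⌊x⌋₊).filter (fun p => p.Prime ∧ Nat.Coprime p m) with hP
  have hmem : ∀ p : ℕ, p ∈ P ↔ p.Prime ∧ (p : ℝ) ≤ x ∧ Nat.Coprime p m := by
    intro p
    rw [hP, Finset.mem_filter, Finset.mem_Icc, Nat.le_floor_iff hx]
    constructor
    · tauto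
    · rintro ⟨h1, h2, h3⟩; exact ⟨⟨h1.one_lt.le, h2⟩, h1, h3⟩
  have hset : T3 m a x y = ((P ×ˢ P ×ˢ P ×ˢ Finset.Icc 1 ⌊y⌋₊).filter (fun t : ℕ × ℕ × ℕ × ℕ =>
      (a : ZMod m) * (t.1 : ZMod m)⁻¹ * (t.2.1 : ZMod m)⁻¹ * (t.2.2.1 : ZMod m)⁻¹
        = (t.2.2.2 : ZMod m))).card := by
    unfold T3
    rw [← Set.ncard_coe_finset]
    congr 1
    ext ⟨p, q, r, v⟩
    simp only [Finset.coe_filter, Finset.mem_product, hmem, Finset.mem_Icc, Nat.le_floor_iff hy]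
    have hz : (a * (minv m p : ℤ) * (minv m q : ℤ) * (minv m r : ℤ) ≡ (v : ℤ) [ZMOD (m : ℤ)]) ↔
        (a : ZMod m) * (p : ZMod m)⁻¹ * (q : ZMod m)⁻¹ * (r : ZMod m)⁻¹ = (v : ZMod m) := by
      rw [← ZMod.intCast_eq_intCast_iff]
      unfold minv
      push_cast
      simp
    change (_ ∧ _ ∧ _ ∧ _ ∧ _ ∧ _ ∧ _ ∧ _ ∧ _ ∧ _ ∧ _ ∧ _) ↔ _
    rw [hz]
    change _ ↔ (_ ∧ _)
    tauto
  rw [hset, Finset.card_filter]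
  push_cast
  simp only [Finset.sum_product]

lemma card_bad (m : ℕ) (hm : 2 ≤ m) : (m.primeFactors.card : ℝ) ≤ 2 * (1 + Real.log m) := by
  have h1 : 2 ^ m.primeFactors.card ≤ m := by
    calc 2 ^ m.primeFactors.card ≤ ∏ p ∈ m.primeFactors, p :=
          Finset.pow_card_le_prod _ _ _ (fun p hp => (Nat.prime_of_mem_primeFactors hp).two_le)
      _ ≤ m := Nat.le_of_dvd (by omega) (Nat.prod_primeFactors_dvd m)
  have h2 : ((2 : ℝ)) ^ m.primeFactors.card ≤ m := by exact_mod_cast h1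
  have h3 := Real.log_le_log (by positivity) h2
  rw [Real.log_pow] at h3
  have h4 := Real.log_two_gt_d9
  have h5 : (0 : ℝ) ≤ m.primeFactors.card := by positivity
  nlinarith

lemma primePi_bounds (m : ℕ) (hm : 2 ≤ m) (x : ℝ) (hx : 0 ≤ x) (P : Finset ℕ)
    (hP : P = (Finset.Icc 1 ⌊x⌋₊).filter (fun p => p.Prime ∧ Nat.Coprime p m)) :
    (P.card : ℝ) ≤ primePi x ∧ (primePi x : ℝ) ≤ P.card + 2 * (1 + Real.log m) ∧
      (primePi x : ℝ) ≤ x := by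
  have hpi : primePi x = ((Finset.Icc 1 ⌊x⌋₊).filter (fun p => p.Prime)).card := by
    unfold primePi
    rw [← Set.ncard_coe_finset]
    congr 1
    ext p
    simp only [Finset.coe_filter, Finset.mem_Icc, Nat.le_floor_iff hx]
    change (_ ∧ _) ↔ (_ ∧ _)
    constructor
    · rintro ⟨h1, h2⟩; exact ⟨⟨h1.one_lt.le, h2⟩, h1⟩
    · tauto
  refine ⟨?_, ?_, ?_⟩
  · rw [hpi, hP]
    exact_mod_cast Finset.card_le_card (by intro p; simp; tauto)
  · refine le_trans ?_ (add_le_add_right (card_bad m hm) _)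
    rw [hpi]
    have : (Finset.Icc 1 ⌊x⌋₊).filter (fun p => p.Prime) ⊆ P ∪ m.primeFactors := by
      intro p hp
      rw [Finset.mem_filter] at hp
      rw [Finset.mem_union, hP, Finset.mem_filter]
      by_cases h : Nat.Coprime p m
      · exact Or.inl ⟨hp.1, hp.2, h⟩
      · right
        rw [Nat.Prime.coprime_iff_not_dvd hp.2, not_not] at h
        exact Nat.mem_primeFactors.2 ⟨hp.2, h, by omega⟩
    exact_mod_cast (Finset.card_le_card this).trans (Finset.card_union_le _ _)
  · rw [hpi]
    have h1 : ((Finset.Icc 1 ⌊x⌋₊).filter (fun p => p.Prime)).card ≤ ⌊x⌋₊ := by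
      refine (Finset.card_filter_le _ _).trans ?_
      simp
    exact (Nat.cast_le.2 h1).trans (Nat.floor_le hx)

set_option maxHeartbeats 1000000 in
lemma final_bound (m : ℕ) (hm : 2 ≤ m) (x y : ℝ) (hx : (m : ℝ) ^ ((1 : ℝ) / 2) ≤ x) (hxm : x ≤ m)
    (hy : 1 ≤ y) (hym : y ≤ m) (a : ℤ) (ha : Int.gcd a m = 1) :
    |(T3 m a x y : ℝ) - (primePi x : ℝ) ^ 3 * y / m| ≤
      11 * (x ^ ((5 : ℝ) / 2) * (1 + Real.log m)) := by
  have : NeZero m := ⟨by omega⟩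
  have hmR : (2 : ℝ) ≤ m := by exact_mod_cast hm
  have hm0 : (0 : ℝ) < m := by linarith
  rw [← Real.sqrt_eq_rpow] at hx
  have hx0 : 0 < x := lt_of_lt_of_le (Real.sqrt_pos.2 hm0) hx
  have hx2 : (m : ℝ) ≤ x ^ 2 := by
    rw [← Real.sqrt_le_left hx0.le]; exact hx
  have hx1 : 1 ≤ x := by nlinarith
  have hL : 1 ≤ 1 + Real.log m := by
    have : 0 ≤ Real.log m := Real.log_natCast_nonneg m
    linarith
  set L := 1 + Real.log m with hLdef
  set P := (Finset.Icc 1 ⌊x⌋₊).filter (fun p => p.Prime ∧ Nat.Coprime p m) with hP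
  obtain ⟨hb1, hb2, hb3⟩ := primePi_bounds m hm x hx0.le P hP
  have hPprop : ∀ p ∈ P, p.Prime ∧ p ≤ ⌊x⌋₊ ∧ Nat.Coprime p m ∧ p < m := by
    intro p hp
    rw [hP, Finset.mem_filter, Finset.mem_Icc] at hp
    refine ⟨hp.2.1, hp.1.2, hp.2.2, ?_⟩
    have h1 : (p : ℝ) ≤ m := ((Nat.le_floor_iff hx0.le).1 hp.1.2).trans hxm
    have h2 : p ≤ m := by exact_mod_cast h1
    refine lt_of_le_of_ne h2 ?_
    intro h
    have h3 := hp.2.2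
    rw [h, Nat.coprime_self] at h3
    omega
  have hau : IsUnit (a : ZMod m) := by
    rw [ZMod.coe_int_isUnit_iff_isCoprime, Int.isCoprime_iff_gcd_eq_one, Int.gcd_comm]
    exact ha
  have hcore := core ⌊x⌋₊ ⌊y⌋₊ P hPprop (a : ZMod m) hau
  have hE : ∑ p ∈ P, ∑ q ∈ P, ∑ r ∈ P, ((∑ v ∈ Finset.Icc 1 ⌊y⌋₊,
      if (a : ZMod m) * (p : ZMod m)⁻¹ * (q : ZMod m)⁻¹ * (r : ZMod m)⁻¹ = (v : ZMod m)
        then (1 : ℝ) else 0) - (⌊y⌋₊ : ℝ) / m) = T3 m a x y - (P.card : ℝ) ^ 3 * ⌊y⌋₊ / m := by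
    rw [T3_eq m a x y hx0.le (by linarith)]
    simp only [Finset.sum_sub_distrib, Finset.sum_const, nsmul_eq_mul]
    ring
  rw [hE] at hcore
  set k : ℝ := (P.card : ℝ) with hk
  set π : ℝ := (primePi x : ℝ) with hπ
  have hk0 : 0 ≤ k := by positivity
  have hkx : k ≤ x := hb1.trans hb3
  set R : ℝ := x ^ ((5 : ℝ) / 2) with hR
  have hR0 : 0 < R := by positivity
  have hR2 : R ^ 2 = x ^ 5 := by
    rw [hR, ← Real.rpow_natCast, ← Real.rpow_mul hx0.le, ← Real.rpow_natCast]
    norm_num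
  have hxR : x ^ 2 ≤ R := by
    rw [hR, ← Real.rpow_natCast]
    exact Real.rpow_le_rpow_of_exponent_le hx1 (by norm_num)
  have hN : ((2 * (⌊x⌋₊ ^ 2 / m + 1) : ℕ) : ℝ) * m ≤ 4 * x ^ 2 := by
    push_cast
    have h1 : ((⌊x⌋₊ ^ 2 / m : ℕ) : ℝ) * m ≤ x ^ 2 := by
      have : ((⌊x⌋₊ ^ 2 / m * m : ℕ) : ℝ) ≤ ((⌊x⌋₊ ^ 2 : ℕ) : ℝ) :=
        Nat.cast_le.2 (Nat.div_mul_le_self _ _)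
      push_cast at this
      refine this.trans ?_
      have := Nat.floor_le hx0.le
      gcongr
    push_cast at h1
    nlinarith
  have hmain : |(T3 m a x y : ℝ) - k ^ 3 * ⌊y⌋₊ / m| ≤ 4 * (R * L) := by
    apply abs_le_of_sq_le_sq' _ (by positivity) |> abs_le.2
    rw [sq_abs] at hcore
    refine hcore.trans ?_
    have hk3 : k ^ 3 ≤ x ^ 3 := by gcongr
    calc _ = (((2 * (⌊x⌋₊ ^ 2 / m + 1) : ℕ) : ℝ) * m) * (4 * L ^ 2) * k ^ 3 := by ring
      _ ≤ (4 * x ^ 2) * (4 * L ^ 2) * x ^ 3 := by gcongr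
      _ = 16 * x ^ 5 * L ^ 2 := by ring
      _ = (4 * (R * L)) ^ 2 := by rw [← hR2]; ring
  have hfl : (⌊y⌋₊ : ℝ) ≤ y := Nat.floor_le (by linarith)
  have hfl2 : y < ⌊y⌋₊ + 1 := Nat.lt_floor_add_one y
  have hdiff1 : |k ^ 3 * ⌊y⌋₊ / m - k ^ 3 * y / m| ≤ R * L := by
    have h1 : k ^ 3 * ⌊y⌋₊ / m - k ^ 3 * y / m = -(k ^ 3 / m * (y - ⌊y⌋₊)) := by ring
    rw [h1, abs_neg, abs_of_nonneg (mul_nonneg (by positivity) (by linarith))]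
    have h2 : k ^ 3 / m ≤ x ^ 2 := by
      rw [div_le_iff₀ hm0]
      calc k ^ 3 ≤ x ^ 3 := by gcongr
        _ = x ^ 2 * x := by ring
        _ ≤ x ^ 2 * m := by gcongr
    calc k ^ 3 / m * (y - ⌊y⌋₊) ≤ x ^ 2 * 1 := by
          apply mul_le_mul h2 (by linarith) (by linarith) (by positivity)
      _ ≤ R * L := mul_le_mul hxR hL zero_le_one hR0.le
  have hdiff2 : |k ^ 3 * y / m - π ^ 3 * y / m| ≤ 6 * (R * L) := by
    have h1 : k ^ 3 * y / m - π ^ 3 * y / m = -((π - k) * (π ^ 2 + π * k + k ^ 2) * (y / m)) := by ring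
    have hπk : 0 ≤ π - k := by linarith
    have hπ0 : 0 ≤ π := by linarith
    have hq : 0 ≤ π ^ 2 + π * k + k ^ 2 := by positivity
    have hym0 : 0 ≤ y / m := div_nonneg (by linarith) hm0.le
    rw [h1, abs_neg, abs_of_nonneg (mul_nonneg (mul_nonneg hπk hq) hym0)]
    have hq2 : π ^ 2 + π * k + k ^ 2 ≤ 3 * x ^ 2 := by
      have i1 : π ^ 2 ≤ x ^ 2 := by gcongr
      have i2 : π * k ≤ x * x := by gcongr
      have i3 : k ^ 2 ≤ x ^ 2 := by gcongr
      rw [← pow_two] at i2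
      linarith
    calc (π - k) * (π ^ 2 + π * k + k ^ 2) * (y / m)
        ≤ (2 * L) * (3 * x ^ 2) * 1 := by
          have j1 : π - k ≤ 2 * L := by linarith
          have j2 : y / m ≤ 1 := by rw [div_le_one hm0]; exact hym
          gcongr
      _ = 6 * (x ^ 2 * L) := by ring
      _ ≤ 6 * (R * L) := by gcongr
  rw [abs_le] at hmain hdiff1 hdiff2 ⊢
  constructor <;> linarith [hmain.1, hmain.2, hdiff1.1, hdiff1.2, hdiff2.1, hdiff2.2]

end Aux13

theorem stmt_13 : ∀ ε : ℝ, 0 < ε → ∃ C : ℝ, 0 < C ∧ ∀ m : ℕ, 2 ≤ m → ∀ x y : ℝ,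
    (m : ℝ) ^ ((1 : ℝ) / 2) ≤ x → x ≤ m → 1 ≤ y → y ≤ m →
    ∀ a : ℤ, Int.gcd a m = 1 →
    |(T3 m a x y : ℝ) - (primePi x : ℝ) ^ 3 * y / m|
      ≤ C * x ^ ((5 : ℝ) / 2 + ε) := by
  intro ε hε
  refine ⟨11 * (1 + 2 / ε), by positivity, ?_⟩
  intro m hm x y hx hxm hy hym a ha
  refine (Aux13.final_bound m hm x y hx hxm hy hym a ha).trans ?_
  have hmR : (2 : ℝ) ≤ m := by exact_mod_cast hm
  have hm0 : (0 : ℝ) < m := by linarith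
  have hx0 : 0 < x := lt_of_lt_of_le (by positivity) hx
  have hx1 : 1 ≤ x := (Real.one_le_rpow (by linarith) (by norm_num)).trans hx
  have hlog : Real.log m ≤ 2 * Real.log x := by
    have := Real.log_le_log (by positivity) hx
    rw [Real.log_rpow hm0] at this
    linarith
  have h1 : Real.log x ≤ x ^ ε / ε := Real.log_le_rpow_div hx0.le hε
  have h2 : 1 ≤ x ^ ε := Real.one_le_rpow hx1 hε.le
  have h3 : 1 + Real.log m ≤ (1 + 2 / ε) * x ^ ε := by
    have : (1 + 2 / ε) * x ^ ε = x ^ ε + 2 * (x ^ ε / ε) := by ring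
    rw [this]; linarith
  rw [Real.rpow_add hx0]
  calc 11 * (x ^ ((5 : ℝ) / 2) * (1 + Real.log m))
      ≤ 11 * (x ^ ((5 : ℝ) / 2) * ((1 + 2 / ε) * x ^ ε)) := by gcongr
    _ = _ := by ring
end
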